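/- Let (g,⟨·,·⟩) be the double extension of (g₀,⟨·,·⟩₀) by (D, K, L). Then (g,⟨·,·⟩) is Ricci-parallel if and only if (g₀,⟨·,·⟩₀) is Ricci-parallel and the following hold: (C1) ⟨L,Δ⟩₀ = 0; (C2) Ric₀(L) = −(1/2)(D−D*−K)(Δ); (C3) Ric₀ commutes with D−D*−K; (C4) (D+D*−K)(Δ) = 0; (C5) ∇⁰_e Δ = −(1/2)Ric₀((D+D*+K)(e)) for all e ∈ g₀. -/

import Mathlib

/-- The Ricci tensor of a left-invariant metric determined by a connection `nabla`:
`ric(x,y) = tr (ξ ↦ ∇_ξ ∇_x y − ∇_x ∇_ξ y − ∇_{[ξ,x]} y)`. -/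
noncomputable def ricci {g : Type*} [LieRing g] [LieAlgebra ℝ g]
    (nabla : g →ₗ[ℝ] g →ₗ[ℝ] g) (x y : g) : ℝ :=
  LinearMap.trace ℝ g
    (nabla.flip (nabla x y) - nabla x ∘ₗ nabla.flip y +
      nabla.flip y ∘ₗ (LieAlgebra.ad ℝ g x : g →ₗ[ℝ] g))

/-- `nabla` is the Levi-Civita connection of the metric Lie algebra `(g, B)`
(Koszul formula). -/
def IsLeviCivita {g : Type*} [LieRing g] [LieAlgebra ℝ g]
    (B : g →ₗ[ℝ] g →ₗ[ℝ] ℝ) (nabla : g →ₗ[ℝ] g →ₗ[ℝ] g) : Prop :=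
  ∀ x y z : g, 2 * B (nabla x y) z = B ⁅x, y⁆ z - B ⁅y, z⁆ x + B ⁅z, x⁆ y

/-- Ricci-parallel: `(∇_x ric)(y,z) = −ric(∇_x y, z) − ric(y, ∇_x z) = 0`. -/
noncomputable def IsRicciParallel {g : Type*} [LieRing g] [LieAlgebra ℝ g]
    (nabla : g →ₗ[ℝ] g →ₗ[ℝ] g) : Prop :=
  ∀ x y z : g, ricci nabla (nabla x y) z + ricci nabla y (nabla x z) = 0



theorem aux_trace_adj {V : Type*} [AddCommGroup V] [Module ℝ V] [FiniteDimensional ℝ V]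
    (B : V →ₗ[ℝ] V →ₗ[ℝ] ℝ) (hnd : ∀ e, (∀ f, B e f = 0) → e = 0)
    (T T' : V →ₗ[ℝ] V) (h : ∀ x y, B (T x) y = B x (T' y)) :
    LinearMap.trace ℝ V T = LinearMap.trace ℝ V T' := by
  have hinj : Function.Injective (B : V →ₗ[ℝ] Module.Dual ℝ V) := by
    rw [← LinearMap.ker_eq_bot, LinearMap.ker_eq_bot']
    intro m hm
    exact hnd m (fun f => by rw [hm]; rfl)
  let E : V ≃ₗ[ℝ] Module.Dual ℝ V :=
    LinearEquiv.ofInjectiveOfFinrankEq (B : V →ₗ[ℝ] Module.Dual ℝ V) hinj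
      (Subspace.dual_finrank_eq).symm
  have hE : ∀ x, E x = B x := fun x => rfl
  have h1 : LinearMap.trace ℝ V T = LinearMap.trace ℝ _ (E.conj T) := by
    rw [LinearMap.trace_conj']
  have h2 : E.conj T = Module.Dual.transpose (R := ℝ) T' := by
    ext φ y
    obtain ⟨x, rfl⟩ := E.surjective φ
    rw [LinearEquiv.conj_apply_apply, E.symm_apply_apply, hE, h, hE]
    rfl
  rw [h1, h2, LinearMap.trace_transpose']

section
variable {g : Type*} [LieRing g] [LieAlgebra ℝ g] [FiniteDimensional ℝ g]
    {B : g →ₗ[ℝ] g →ₗ[ℝ] ℝ} {nabla : g →ₗ[ℝ] g →ₗ[ℝ] g}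

theorem aux_torsion (hnd : ∀ e, (∀ f, B e f = 0) → e = 0) (hLC : IsLeviCivita B nabla) (x y : g) :
    nabla x y = nabla y x + ⁅x, y⁆ := by
  rw [← sub_eq_zero]
  apply hnd
  intro z
  have h1 := hLC x y z
  have h2 := hLC y x z
  rw [← lie_skew y x, ← lie_skew x z, ← lie_skew z y] at h2
  simp only [map_sub, map_add, map_neg, LinearMap.sub_apply, LinearMap.add_apply,
    LinearMap.neg_apply] at *
  linarith

theorem aux_skew (hs : ∀ e f, B e f = B f e) (hLC : IsLeviCivita B nabla) (x y z : g) :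
    B (nabla x y) z = - B y (nabla x z) := by
  have h1 := hLC x y z
  have h2 := hLC x z y
  rw [← lie_skew y x, ← lie_skew x z, ← lie_skew z y] at h2
  rw [hs y (nabla x z)]
  simp only [map_sub, map_add, map_neg, LinearMap.sub_apply, LinearMap.add_apply,
    LinearMap.neg_apply] at *
  linarith

theorem aux_flip (hnd : ∀ e, (∀ f, B e f = 0) → e = 0) (hLC : IsLeviCivita B nabla) (y : g) :
    nabla.flip y = nabla y - (LieAlgebra.ad ℝ g y : g →ₗ[ℝ] g) := by
  ext x
  simp only [LinearMap.flip_apply, LinearMap.sub_apply, LieAlgebra.ad_apply]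
  rw [aux_torsion hnd hLC x y, ← lie_skew x y]; abel

theorem aux_trace_nabla (hs : ∀ e f, B e f = B f e) (hnd : ∀ e, (∀ f, B e f = 0) → e = 0)
    (hLC : IsLeviCivita B nabla) (x : g) : LinearMap.trace ℝ g (nabla x) = 0 := by
  have := aux_trace_adj B hnd (nabla x) (-(nabla x)) (fun a b => by
    simp [aux_skew hs hLC x a b])
  rw [map_neg] at this
  linarith

theorem aux_trace_flip (hs : ∀ e f, B e f = B f e) (hnd : ∀ e, (∀ f, B e f = 0) → e = 0)
    (hLC : IsLeviCivita B nabla) (x : g) : LinearMap.trace ℝ g (nabla.flip x) =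
      - LinearMap.trace ℝ g (LieAlgebra.ad ℝ g x : g →ₗ[ℝ] g) := by
  rw [aux_flip hnd hLC, map_sub, aux_trace_nabla hs hnd hLC]; ring

theorem aux_tr_ad_lie (x y : g) :
    LinearMap.trace ℝ g (LieAlgebra.ad ℝ g ⁅x, y⁆ : g →ₗ[ℝ] g) = 0 := by
  have : (LieAlgebra.ad ℝ g ⁅x, y⁆ : g →ₗ[ℝ] g) =
      (LieAlgebra.ad ℝ g x : g →ₗ[ℝ] g) ∘ₗ (LieAlgebra.ad ℝ g y : g →ₗ[ℝ] g) -
      (LieAlgebra.ad ℝ g y : g →ₗ[ℝ] g) ∘ₗ (LieAlgebra.ad ℝ g x : g →ₗ[ℝ] g) := by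
    ext z
    simp
  rw [this, map_sub, LinearMap.trace_comp_comm', sub_self]

theorem aux_ricci_symm (hs : ∀ e f, B e f = B f e) (hnd : ∀ e, (∀ f, B e f = 0) → e = 0)
    (hLC : IsLeviCivita B nabla) (x y : g) : ricci nabla x y = ricci nabla y x := by
  unfold ricci
  simp only [map_add, map_sub, aux_trace_flip hs hnd hLC]
  rw [aux_torsion hnd hLC x y]
  rw [aux_flip hnd hLC x, aux_flip hnd hLC y]
  simp only [map_add, map_sub, LinearMap.comp_sub, LinearMap.sub_comp, aux_tr_ad_lie]
  rw [LinearMap.trace_comp_comm' (nabla y) (nabla x),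
    LinearMap.trace_comp_comm' (LieAlgebra.ad ℝ g x : g →ₗ[ℝ] g) (LieAlgebra.ad ℝ g y : g →ₗ[ℝ] g)]
  ring
end

theorem aux_trace_ext {g₀ g : Type*} [AddCommGroup g₀] [Module ℝ g₀] [FiniteDimensional ℝ g₀]
    [AddCommGroup g] [Module ℝ g] [FiniteDimensional ℝ g]
    (u v : g) (ι : g₀ →ₗ[ℝ] g)
    (hspan : ∀ w : g, ∃ (a b : ℝ) (e : g₀), w = a • u + b • v + ι e)
    (hinj : ∀ (a b : ℝ) (e : g₀), a • u + b • v + ι e = 0 → a = 0 ∧ b = 0 ∧ e = 0)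
    (T : g →ₗ[ℝ] g) (T₀ : g₀ →ₗ[ℝ] g₀) (hv : T v = 0)
    (hu : ∃ (b : ℝ) (e : g₀), T u = b • v + ι e)
    (he : ∀ e, ∃ b : ℝ, T (ι e) = ι (T₀ e) + b • v) :
    LinearMap.trace ℝ g T = LinearMap.trace ℝ g₀ T₀ := by
  let φ : ((ℝ × ℝ) × g₀) →ₗ[ℝ] g :=
    ((LinearMap.toSpanSingleton ℝ g u).coprod (LinearMap.toSpanSingleton ℝ g v)).coprod ι
  have hφ : ∀ a b e, φ ((a, b), e) = a • u + b • v + ι e := fun a b e => by simp [φ]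
  let E : ((ℝ × ℝ) × g₀) ≃ₗ[ℝ] g := LinearEquiv.ofBijective φ (by
    constructor
    · rw [← LinearMap.ker_eq_bot, LinearMap.ker_eq_bot']
      rintro ⟨⟨a, b⟩, e⟩ h
      rw [hφ] at h
      obtain ⟨rfl, rfl, rfl⟩ := hinj _ _ _ h
      rfl
    · intro w
      obtain ⟨a, b, e, rfl⟩ := hspan w
      exact ⟨((a, b), e), hφ _ _ _⟩)
  have hE : ∀ a b e, E ((a, b), e) = a • u + b • v + ι e := hφ
  let α : g →ₗ[ℝ] ℝ := LinearMap.fst ℝ ℝ ℝ ∘ₗ LinearMap.fst ℝ (ℝ × ℝ) g₀ ∘ₗ E.symm.toLinearMap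
  let β : g →ₗ[ℝ] ℝ := LinearMap.snd ℝ ℝ ℝ ∘ₗ LinearMap.fst ℝ (ℝ × ℝ) g₀ ∘ₗ E.symm.toLinearMap
  let π : g →ₗ[ℝ] g₀ := LinearMap.snd ℝ (ℝ × ℝ) g₀ ∘ₗ E.symm.toLinearMap
  have hα : ∀ a b e, α (a • u + b • v + ι e) = a := fun a b e => by rw [← hE]; simp [α]
  have hπ : ∀ a b e, π (a • u + b • v + ι e) = e := fun a b e => by rw [← hE]; simp [π]
  have hid : ∀ w, w = α w • u + β w • v + ι (π w) := fun w => by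
    rw [← hE]; simp [α, β, π]
  have hT : T = α.smulRight (T u) + (T ∘ₗ ι) ∘ₗ π := by
    ext w
    conv_lhs => rw [hid w]
    simp [hv]
  obtain ⟨b, e, hu⟩ := hu
  have h1 : LinearMap.trace ℝ g (α.smulRight (T u)) = 0 := by
    rw [LinearMap.trace_smulRight, hu]
    simpa using hα 0 b e
  have h2 : π ∘ₗ (T ∘ₗ ι) = T₀ := by
    ext e
    obtain ⟨b, hb⟩ := he e
    simp only [LinearMap.comp_apply, hb]
    have h0 : ι (T₀ e) + b • v = (0:ℝ) • u + b • v + ι (T₀ e) := by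
      rw [zero_smul, zero_add, add_comm]
    rw [h0, hπ]
  calc LinearMap.trace ℝ g T = LinearMap.trace ℝ g (α.smulRight (T u) + (T ∘ₗ ι) ∘ₗ π) :=
        congrArg _ hT
    _ = _ := by rw [map_add, h1, zero_add, LinearMap.trace_comp_comm', h2]

/-- A double extension is Ricci-parallel iff the base is Ricci-parallel and the
five conditions (C1)–(C5) hold. -/
theorem stmt_15 (g₀ : Type*) [LieRing g₀] [LieAlgebra ℝ g₀] [FiniteDimensional ℝ g₀]
    (B₀ : g₀ →ₗ[ℝ] g₀ →ₗ[ℝ] ℝ)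
    (hsymm₀ : ∀ e f : g₀, B₀ e f = B₀ f e)
    (hnd₀ : ∀ e : g₀, (∀ f : g₀, B₀ e f = 0) → e = 0)
    (nabla₀ : g₀ →ₗ[ℝ] g₀ →ₗ[ℝ] g₀)
    (hLC₀ : IsLeviCivita B₀ nabla₀)
    (D K Dstar : g₀ →ₗ[ℝ] g₀) (L : g₀)
    (hD : ∀ e f : g₀, D ⁅e, f⁆ = ⁅D e, f⁆ + ⁅e, D f⁆)
    (hDstar : ∀ e f : g₀, B₀ (Dstar e) f = B₀ e (D f))
    (hKskew : ∀ e f : g₀, B₀ (K e) f = -(B₀ e (K f)))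
    (hJacobi : ∀ e f : g₀, B₀ L ⁅e, f⁆ = B₀ ((K ∘ₗ D + Dstar ∘ₗ K) e) f)
    (g : Type*) [LieRing g] [LieAlgebra ℝ g] [FiniteDimensional ℝ g]
    (u v : g) (ι : g₀ →ₗ[ℝ] g)
    (hspan : ∀ w : g, ∃ (a b : ℝ) (e : g₀), w = a • u + b • v + ι e)
    (hbr1 : ∀ e : g₀, ⁅u, ι e⁆ = ι (D e) + (B₀ L e) • v)
    (hbr2 : ∀ e f : g₀, ⁅ι e, ι f⁆ = ι ⁅e, f⁆ + (B₀ (K e) f) • v)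
    (hbr3 : ∀ x : g, ⁅x, v⁆ = 0)
    (B : g →ₗ[ℝ] g →ₗ[ℝ] ℝ)
    (hB : ∀ (a b a' b' : ℝ) (e e' : g₀),
      B (a • u + b • v + ι e) (a' • u + b' • v + ι e')
        = a * b' + a' * b + B₀ e e')
    (hnd : ∀ w : g, (∀ z : g, B w z = 0) → w = 0)
    (nabla : g →ₗ[ℝ] g →ₗ[ℝ] g)
    (hLC : IsLeviCivita B nabla)
    (Z₀ : g₀)
    (hZ : ∀ f : g₀, B₀ Z₀ f = LinearMap.trace ℝ g₀ (LieAlgebra.ad ℝ g₀ f : g₀ →ₗ[ℝ] g₀))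
    (S : g₀ →ₗ[ℝ] g₀ →ₗ[ℝ] g₀)
    (hS : ∀ e f f' : g₀, B₀ (S e f) f' = B₀ e ⁅f, f'⁆)
    (Δ : g₀)
    (hΔ : ∀ e : g₀, B₀ Δ e
      = -(1/2) * LinearMap.trace ℝ g₀ ((D + Dstar) ∘ₗ (LieAlgebra.ad ℝ g₀ e : g₀ →ₗ[ℝ] g₀))
        + (1/2) * B₀ ((D - K) Z₀) e - (1/4) * LinearMap.trace ℝ g₀ (K ∘ₗ S e))
    (Γ : ℝ)
    (hΓ : Γ = -(1/2) * LinearMap.trace ℝ g₀ (D ∘ₗ D)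
        - (1/2) * LinearMap.trace ℝ g₀ (Dstar ∘ₗ D)
        - (1/4) * LinearMap.trace ℝ g₀ (K ∘ₗ K) + B₀ L Z₀)
    (Ric : g →ₗ[ℝ] g)
    (hRic : ∀ x y : g, B (Ric x) y = ricci nabla x y)
    (Ric₀ : g₀ →ₗ[ℝ] g₀)
    (hRic₀ : ∀ e f : g₀, B₀ (Ric₀ e) f = ricci nabla₀ e f) :
    IsRicciParallel nabla ↔
      (IsRicciParallel nabla₀ ∧
       B₀ L Δ = 0 ∧
       Ric₀ L = -((1/2 : ℝ) • ((D - Dstar - K) Δ)) ∧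
       Ric₀ ∘ₗ (D - Dstar - K) = (D - Dstar - K) ∘ₗ Ric₀ ∧
       (D + Dstar - K) Δ = 0 ∧
       (∀ e : g₀, nabla₀ e Δ = -((1/2 : ℝ) • Ric₀ ((D + Dstar + K) e)))) := by
  have hι : ∀ e : g₀, ι e = (0:ℝ) • u + (0:ℝ) • v + ι e := fun e => by simp
  have hu' : u = (1:ℝ) • u + (0:ℝ) • v + ι 0 := by simp
  have hv' : v = (0:ℝ) • u + (1:ℝ) • v + ι 0 := by simp
  have hsymm : ∀ x y, B x y = B y x := by
    intro x y
    obtain ⟨a, b, e, rfl⟩ := hspan x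
    obtain ⟨a', b', e', rfl⟩ := hspan y
    rw [hB, hB, hsymm₀ e e']; ring
  have Buu : B u u = 0 := by
    have := hB 1 0 1 0 0 0
    simpa using this
  have Buv : B u v = 1 := by
    have := hB 1 0 0 1 0 0
    simpa using this
  have Bvu : B v u = 1 := by rw [hsymm, Buv]
  have Bvv : B v v = 0 := by
    have := hB 0 1 0 1 0 0
    simpa using this
  have Bue : ∀ e, B u (ι e) = 0 := fun e => by
    have := hB 1 0 0 0 0 e
    simpa using this
  have Beu : ∀ e, B (ι e) u = 0 := fun e => by rw [hsymm, Bue]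
  have Bve : ∀ e, B v (ι e) = 0 := fun e => by
    have := hB 0 1 0 0 0 e
    simpa using this
  have Bev : ∀ e, B (ι e) v = 0 := fun e => by rw [hsymm, Bve]
  have Bee : ∀ e f, B (ι e) (ι f) = B₀ e f := fun e f => by
    have := hB 0 0 0 0 e f
    simpa using this
  have hinj : ∀ (a b : ℝ) (e : g₀), a • u + b • v + ι e = 0 → a = 0 ∧ b = 0 ∧ e = 0 := by
    intro a b e h
    have h1 := congrArg (fun w => B w u) h
    have h2 := congrArg (fun w => B w v) h
    simp [Buu, Bvu, Beu, Buv, Bvv, Bev] at h1 h2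
    refine ⟨h2, h1, hnd₀ e fun f => ?_⟩
    have h3 := congrArg (fun w => B w (ι f)) h
    simpa [Bue, Bve, Bee] using h3
  have hbr3' : ∀ x : g, ⁅v, x⁆ = 0 := fun x => by rw [← lie_skew, hbr3, neg_zero]
  have hbr1' : ∀ e : g₀, ⁅ι e, u⁆ = -(ι (D e) + (B₀ L e) • v) := fun e => by
    rw [← lie_skew, hbr1]
  -- test vectors
  have hext : ∀ w w' : g, B w u = B w' u → B w v = B w' v → (∀ f, B w (ι f) = B w' (ι f)) →
      w = w' := by
    intro w w' h1 h2 h3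
    rw [← sub_eq_zero]
    apply hnd
    intro z
    obtain ⟨a, b, e, rfl⟩ := hspan z
    simp [h1, h2, h3]
  have nv : ∀ x, nabla v x = 0 := by
    intro x
    obtain ⟨a, b, e, rfl⟩ := hspan x
    apply hext
    · have := hLC v (a • u + b • v + ι e) u
      simp [hbr3, hbr3', hbr1', Bvv, Bev] at this
      simpa using this
    · have := hLC v (a • u + b • v + ι e) v
      simp [hbr3, hbr3', hbr1', Bvv, Bev] at this
      simpa using this
    · intro f
      have := hLC v (a • u + b • v + ι e) (ι f)
      simp [hbr3, hbr3', hbr1, hbr2, Bvv, Bev] at this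
      simpa using this
  have nxv : ∀ x, nabla x v = 0 := by
    intro x
    rw [aux_torsion hnd hLC, nv, hbr3, add_zero]
  have nuu : nabla u u = - ι L := by
    apply hext
    · have := hLC u u u
      simp at this
      simp [this, Beu]
    · have := hLC u u v
      simp [hbr3, hbr3'] at this
      simp [this, Bev]
    · intro f
      have := hLC u u (ι f)
      simp [hbr1, hbr1', Bvu, Beu] at this
      simp only [map_neg, LinearMap.neg_apply, Bee]
      linarith
  have nue : ∀ e, nabla u (ι e) = ι ((1/2 : ℝ) • (D - Dstar - K) e) + (B₀ L e) • v := by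
    intro e
    apply hext
    · have := hLC u (ι e) u
      simp [hbr1, hbr1', Bvu, Beu] at this
      simp [Beu, Bvu]
      linarith
    · have := hLC u (ι e) v
      simp [hbr1, hbr1', hbr3, hbr3', Bvv, Bev] at this
      simp [Bev, Bvv, this]
    · intro f
      have := hLC u (ι e) (ι f)
      simp [hbr1, hbr1', hbr2, Bvu, Beu, Bee, Bve] at this
      simp only [map_add, map_smul, map_sub, LinearMap.add_apply, LinearMap.smul_apply,
        LinearMap.sub_apply, Bee, Bve, hDstar, smul_eq_mul]
      rw [hsymm₀ (D f) e] at this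
      linarith
  have neu : ∀ e, nabla (ι e) u = -ι ((1/2 : ℝ) • (D + Dstar + K) e) := by
    intro e
    rw [aux_torsion hnd hLC, nue, hbr1']
    simp only [map_add, map_smul, map_sub, LinearMap.add_apply, LinearMap.sub_apply]
    module
  have nee : ∀ e f, nabla (ι e) (ι f) = ι (nabla₀ e f) +
      ((1/2 : ℝ) * B₀ ((D + Dstar + K) e) f) • v := by
    intro e f
    apply hext
    · have := hLC (ι e) (ι f) u
      simp [hbr1, hbr1', hbr2, Bvu, Beu, Bee, Bve] at this
      simp only [map_add, map_smul, map_sub, LinearMap.add_apply, LinearMap.smul_apply,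
        LinearMap.sub_apply, Bvu, Beu, hDstar, smul_eq_mul]
      rw [hsymm₀ (D f) e] at this
      linarith
    · have := hLC (ι e) (ι f) v
      simp [hbr3, hbr3', hbr2, Bvv, Bev] at this
      simp [Bev, Bvv, this]
    · intro f'
      have := hLC (ι e) (ι f) (ι f')
      have h2 := hLC₀ e f f'
      simp [hbr2, Bee, Bve] at this
      simp [Bee, Bve]
      linarith
  have hrs := aux_ricci_symm hsymm hnd hLC
  have hrs₀ := aux_ricci_symm hsymm₀ hnd₀ hLC₀
  have rxv : ∀ x, ricci nabla x v = 0 := by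
    intro x
    have hf : nabla.flip v = 0 := by
      ext x
      simpa using nxv x
    simp [ricci, nxv, hf]
  have rvx : ∀ x, ricci nabla v x = 0 := fun x => by rw [hrs, rxv]
  have noU : ∀ w, B w v = 0 → ∃ (b : ℝ) (e : g₀), w = b • v + ι e := by
    intro w hw
    obtain ⟨a, b, e, rfl⟩ := hspan w
    simp [Buv, Bvv, Bev] at hw
    exact ⟨b, e, by simp [hw]⟩
  have Bnv : ∀ x y, B (nabla x y) v = 0 := fun x y => by
    rw [aux_skew hsymm hLC, nxv]; simp
  have ree : ∀ e f, ricci nabla (ι e) (ι f) = ricci nabla₀ e f := by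
    intro e f
    unfold ricci
    apply aux_trace_ext u v ι hspan hinj
    · simp [nv, hbr3]
    · apply noU
      simp [Bnv]
    · intro ξ
      refine ⟨(1/2) * (B₀ ((D + Dstar + K) ξ) (nabla₀ e f) - B₀ ((D + Dstar + K) e) (nabla₀ ξ f)
        + B₀ ((D + Dstar + K) ⁅e, ξ⁆) f), ?_⟩
      simp only [LinearMap.add_apply, LinearMap.sub_apply, LinearMap.comp_apply,
        LinearMap.flip_apply, LieAlgebra.ad_apply, nee, hbr2, map_add, map_smul, map_sub,
        nxv, nv, LinearMap.smul_apply, smul_zero, add_zero]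
      module
  have reu : ∀ e, ricci nabla (ι e) u = B₀ Δ e := by
    intro e
    obtain ⟨Sy, hSy⟩ : ∃ Sy : g₀ →ₗ[ℝ] g₀, Sy = (1/2 : ℝ) • (D + Dstar + K) := ⟨_, rfl⟩
    have neu' : ∀ e, nabla (ι e) u = -ι (Sy e) := fun e => by rw [neu, hSy]; rfl
    have h1 : ricci nabla (ι e) u = LinearMap.trace ℝ g₀ (-(nabla₀.flip (Sy e)) + nabla₀ e ∘ₗ Sy
        - Sy ∘ₗ (LieAlgebra.ad ℝ g₀ e : g₀ →ₗ[ℝ] g₀)) := by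
      unfold ricci
      apply aux_trace_ext u v ι hspan hinj
      · simp [nv, hbr3]
      · apply noU
        simp [Bnv]
      · intro ξ
        refine ⟨(1/2) * (- B₀ ((D + Dstar + K) ξ) (Sy e) + B₀ ((D + Dstar + K) e) (Sy ξ)), ?_⟩
        simp only [LinearMap.add_apply, LinearMap.sub_apply, LinearMap.comp_apply,
          LinearMap.flip_apply, LieAlgebra.ad_apply, neu', nee, hbr2, map_add, map_smul, map_sub,
          nxv, nv, LinearMap.smul_apply, smul_zero, add_zero, map_neg, LinearMap.neg_apply]
        module
    have hDD : ∀ e f, B₀ (D e) f = B₀ e (Dstar f) := fun e f => by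
      rw [hsymm₀, ← hDstar, hsymm₀]
    have h2 : ∀ e, LinearMap.trace ℝ g₀ (LieAlgebra.ad ℝ g₀ (D e) : g₀ →ₗ[ℝ] g₀) = 0 := by
      intro e
      have : (LieAlgebra.ad ℝ g₀ (D e) : g₀ →ₗ[ℝ] g₀) =
          D ∘ₗ (LieAlgebra.ad ℝ g₀ e : g₀ →ₗ[ℝ] g₀) - (LieAlgebra.ad ℝ g₀ e : g₀ →ₗ[ℝ] g₀) ∘ₗ D := by
        ext f
        simp [hD]
      rw [this, map_sub, LinearMap.trace_comp_comm' D, sub_self]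
    have h3 : B₀ Z₀ (D e) = 0 := by rw [hZ, h2]
    have h4 : LinearMap.trace ℝ g₀ (nabla₀ e ∘ₗ (D + Dstar)) = 0 := by
      have := aux_trace_adj B₀ hnd₀ (nabla₀ e ∘ₗ (D + Dstar)) (-((D + Dstar) ∘ₗ nabla₀ e))
        (fun x y => by
          simp only [LinearMap.comp_apply, aux_skew hsymm₀ hLC₀, LinearMap.add_apply, map_add,
            LinearMap.neg_apply, hDstar, hDD, map_neg]
          ring)
      rw [map_neg, LinearMap.trace_comp_comm' _ (D + Dstar)] at this
      linarith
    -- adjoint of ad e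
    obtain ⟨P, hP⟩ : ∃ P : g₀ →ₗ[ℝ] g₀, P = (LieAlgebra.ad ℝ g₀ e : g₀ →ₗ[ℝ] g₀) - S e
        - (2 : ℝ) • nabla₀ e := ⟨_, rfl⟩
    have hPadj : ∀ x y, B₀ (P x) y = B₀ x ⁅e, y⁆ := by
      intro x y
      have := hLC₀ e x y
      rw [← lie_skew y e] at this
      simp only [hP, LinearMap.sub_apply, LinearMap.smul_apply, map_sub, map_smul, hS,
        LieAlgebra.ad_apply, smul_eq_mul, this, map_neg, LinearMap.neg_apply]
      rw [hsymm₀ ⁅x, y⁆ e, hsymm₀ x ⁅e, y⁆]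
      ring
    have h5 : LinearMap.trace ℝ g₀ (K ∘ₗ P) = - LinearMap.trace ℝ g₀ (K ∘ₗ (LieAlgebra.ad ℝ g₀ e : g₀ →ₗ[ℝ] g₀)) := by
      have := aux_trace_adj B₀ hnd₀ (K ∘ₗ P) (-((LieAlgebra.ad ℝ g₀ e : g₀ →ₗ[ℝ] g₀) ∘ₗ K))
        (fun x y => by
          simp only [LinearMap.comp_apply, hKskew, hPadj, LinearMap.neg_apply, map_neg,
            LieAlgebra.ad_apply])
      rw [map_neg, LinearMap.trace_comp_comm' K] at this
      exact this
    have h6 : LinearMap.trace ℝ g₀ (nabla₀ e ∘ₗ K) =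
        LinearMap.trace ℝ g₀ (K ∘ₗ (LieAlgebra.ad ℝ g₀ e : g₀ →ₗ[ℝ] g₀))
          - (1/2) * LinearMap.trace ℝ g₀ (K ∘ₗ S e) := by
      rw [hP] at h5
      simp only [LinearMap.comp_sub, LinearMap.comp_smul, map_sub, map_smul, smul_eq_mul] at h5
      rw [LinearMap.trace_comp_comm' K (nabla₀ e)]
      linarith
    have h7 := hΔ e
    rw [h1, h7]
    simp only [map_add, map_sub, map_neg, aux_trace_flip hsymm₀ hnd₀ hLC₀, ← hZ]
    rw [hSy]
    simp only [LinearMap.comp_smul, LinearMap.smul_comp, LinearMap.comp_add, LinearMap.add_comp,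
      map_add, map_smul, LinearMap.smul_apply, LinearMap.add_apply, LinearMap.sub_apply, map_sub,
      smul_eq_mul, hDD, hKskew] at h4 ⊢
    rw [h3, h6]
    linarith
  have rue : ∀ e, ricci nabla u (ι e) = B₀ Δ e := fun e => by rw [hrs, reu]
  -- bilinearity of `ricci`
  have radd : ∀ x x' y, ricci nabla (x + x') y = ricci nabla x y + ricci nabla x' y := by
    intro x x' y
    simp [← hRic]
  have rsmul : ∀ (c : ℝ) x y, ricci nabla (c • x) y = c * ricci nabla x y := by
    intro c x y
    simp [← hRic]
  have radd' : ∀ x y y', ricci nabla x (y + y') = ricci nabla x y + ricci nabla x y' := by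
    intro x x' y
    simp [← hRic]
  have rsmul' : ∀ (c : ℝ) x y, ricci nabla x (c • y) = c * ricci nabla x y := by
    intro c x y
    simp [← hRic]
  have rneg : ∀ x y, ricci nabla (-x) y = - ricci nabla x y := by
    intro x y
    simp [← hRic]
  have rneg' : ∀ x y, ricci nabla x (-y) = - ricci nabla x y := by
    intro x y
    simp [← hRic]
  have hext₀ : ∀ e e' : g₀, (∀ f, B₀ e f = B₀ e' f) → e = e' := by
    intro e e' h
    rw [← sub_eq_zero]
    apply hnd₀
    intro f
    simp [h]
  have hDD : ∀ e f, B₀ (D e) f = B₀ e (Dstar f) := fun e f => by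
    rw [hsymm₀, ← hDstar, hsymm₀]
  have hsk₀ := aux_skew hsymm₀ hLC₀
  -- the components of the covariant derivative of the Ricci tensor
  have Fuuu : ricci nabla (nabla u u) u + ricci nabla u (nabla u u) = -2 * B₀ L Δ := by
    rw [nuu, rneg, rneg', reu, rue, hsymm₀]; ring
  have Fuuf : ∀ f, ricci nabla (nabla u u) (ι f) + ricci nabla u (nabla u (ι f)) =
      -B₀ (Ric₀ L + (1/2 : ℝ) • ((D - Dstar - K) Δ)) f := by
    intro f
    rw [nuu, nue, rneg, radd', rsmul', rxv, ree, rue, ← hRic₀]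
    simp only [map_add, map_smul, map_sub, LinearMap.add_apply, LinearMap.smul_apply,
        LinearMap.sub_apply, smul_eq_mul, hDD, hKskew, hDstar]
    ring
  have Fuef : ∀ e f, ricci nabla (nabla u (ι e)) (ι f) + ricci nabla (ι e) (nabla u (ι f)) =
      (1/2) * B₀ (Ric₀ ((D - Dstar - K) e) - (D - Dstar - K) (Ric₀ e)) f := by
    intro e f
    rw [nue, nue, radd, radd', rsmul', rxv, rsmul, rvx, ree, ree, ← hRic₀, ← hRic₀]
    simp only [map_add, map_smul, map_sub, LinearMap.add_apply, LinearMap.smul_apply,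
        LinearMap.sub_apply, smul_eq_mul, hDD, hKskew, hDstar]
    ring
  have Feuu : ∀ e, ricci nabla (nabla (ι e) u) u + ricci nabla u (nabla (ι e) u) =
      - B₀ ((D + Dstar - K) Δ) e := by
    intro e
    rw [neu, rneg, rneg', reu, rue]
    simp only [map_add, map_smul, map_sub, LinearMap.add_apply, LinearMap.smul_apply,
        LinearMap.sub_apply, smul_eq_mul, hDD, hKskew, hDstar]
    ring
  have Feuf : ∀ e f, ricci nabla (nabla (ι e) u) (ι f) + ricci nabla u (nabla (ι e) (ι f)) =
      - B₀ (nabla₀ e Δ + (1/2 : ℝ) • Ric₀ ((D + Dstar + K) e)) f := by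
    intro e f
    rw [neu, nee, rneg, radd', rsmul', rxv, ree, rue, ← hRic₀]
    simp only [map_add, map_smul, map_sub, LinearMap.add_apply, LinearMap.smul_apply,
        LinearMap.sub_apply, smul_eq_mul, hsk₀]
    ring
  have Fefh : ∀ e f h, ricci nabla (nabla (ι e) (ι f)) (ι h) + ricci nabla (ι f) (nabla (ι e) (ι h)) =
      ricci nabla₀ (nabla₀ e f) h + ricci nabla₀ f (nabla₀ e h) := by
    intro e f h
    rw [nee, nee, radd, radd', rsmul', rxv, rsmul, rvx, ree, ree]
    ring
  constructor
  · intro H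
    refine ⟨?_, ?_, ?_, ?_, ?_, ?_⟩
    · intro e f h
      rw [← Fefh]; exact H _ _ _
    · have := H u u u
      rw [Fuuu] at this; linarith
    · rw [← sub_eq_zero, sub_neg_eq_add]
      apply hnd₀
      intro f
      have := H u u (ι f)
      rw [Fuuf] at this; linarith
    · ext e
      rw [← sub_eq_zero]
      apply hnd₀
      intro f
      have := H u (ι e) (ι f)
      rw [Fuef] at this
      simp only [LinearMap.comp_apply]
      linarith
    · apply hnd₀
      intro f
      have := H (ι f) u u
      rw [Feuu] at this; linarith
    · intro e
      rw [← sub_eq_zero, sub_neg_eq_add]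
      apply hnd₀
      intro f
      have := H (ι e) u (ι f)
      rw [Feuf] at this; linarith
  · rintro ⟨H0, C1, C2, C3, C4, C5⟩
    have Guuf : ∀ f, ricci nabla (nabla u u) (ι f) + ricci nabla u (nabla u (ι f)) = 0 := by
      intro f
      rw [Fuuf, C2]; simp
    have Gufu : ∀ f, ricci nabla (nabla u (ι f)) u + ricci nabla (ι f) (nabla u u) = 0 := by
      intro f
      rw [hrs _ u, hrs (ι f), add_comm, Guuf]
    have Guef : ∀ e f, ricci nabla (nabla u (ι e)) (ι f) + ricci nabla (ι e) (nabla u (ι f)) = 0 := by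
      intro e f
      have := LinearMap.congr_fun C3 e
      simp only [LinearMap.comp_apply] at this
      rw [Fuef, this]; simp
    have Geuf : ∀ e f, ricci nabla (nabla (ι e) u) (ι f) + ricci nabla u (nabla (ι e) (ι f)) = 0 := by
      intro e f
      rw [Feuf, C5, neg_add_cancel]; simp
    have Gefu : ∀ e f, ricci nabla (nabla (ι e) (ι f)) u + ricci nabla (ι f) (nabla (ι e) u) = 0 := by
      intro e f
      rw [hrs _ u, hrs (ι f), add_comm, Geuf]
    have Geuu : ∀ e, ricci nabla (nabla (ι e) u) u + ricci nabla u (nabla (ι e) u) = 0 := by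
      intro e
      rw [Feuu, C4]; simp
    have Guuu : ricci nabla (nabla u u) u + ricci nabla u (nabla u u) = 0 := by
      rw [Fuuu, C1]; simp
    have Gefh : ∀ e f h, ricci nabla (nabla (ι e) (ι f)) (ι h) + ricci nabla (ι f) (nabla (ι e) (ι h)) = 0 := by
      intro e f h
      rw [Fefh]; exact H0 e f h
    intro x y z
    obtain ⟨a, b, e, rfl⟩ := hspan x
    obtain ⟨a', b', f, rfl⟩ := hspan y
    obtain ⟨a'', b'', h, rfl⟩ := hspan z
    simp only [map_add, map_smul, LinearMap.add_apply, LinearMap.smul_apply, nv, nxv, smul_zero,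
      add_zero]
    simp only [radd, radd', rsmul, rsmul', rxv, rvx]
    linear_combination a * a' * a'' * Guuu + a * a' * Guuf h + a * a'' * Gufu f + a * Guef f h
      + a' * a'' * Geuu e + a' * Geuf e h + a'' * Gefu e f + Gefh e f h
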